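/- arXiv:2308.03141 — 3 statements merged into one kernel-verified Lean document; each statement's English description precedes it below -/
import Mathlib

section
/- Let A = R/I be a narrow artinian quotient of R = k[x_1,...,x_n] with s(A) = d and dim_k (I^⊥)_{-d} = a ≥ 1. Then A is compressed and its Hilbert function is HF_A(i) = dim_k R_i for i ≤ d-1, HF_A(d) = a, and HF_A(i) = 0 for i > d. -/
open MvPolynomial

noncomputable section
namespace PSI

open scoped Classical

variable (k : Type) [Field k] (n : ℕ)

/-- The contraction action of `R = k[x_1,…,x_n]` on its graded dual `S`, where `S` is
modeled by polynomials in the dual variables `y_i` (dual basis to the monomial basis);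
on basis elements, `x^d ∘ y^(e) = y^(e-d)` if `d ≤ e` componentwise and `0` otherwise. -/
def contract (f g : MvPolynomial (Fin n) k) : MvPolynomial (Fin n) k :=
  ∑ d ∈ f.support, f.coeff d • g.divMonomial d

theorem divMonomial_add (a b : MvPolynomial (Fin n) k) (s : Fin n →₀ ℕ) :
    (a + b).divMonomial s = a.divMonomial s + b.divMonomial s := by
  ext c; simp [MvPolynomial.coeff_divMonomial]

theorem divMonomial_smul (r : k) (a : MvPolynomial (Fin n) k) (s : Fin n →₀ ℕ) :
    (r • a).divMonomial s = r • a.divMonomial s := by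
  ext c; simp [MvPolynomial.coeff_divMonomial]

theorem divMonomial_zero (s : Fin n →₀ ℕ) :
    (0 : MvPolynomial (Fin n) k).divMonomial s = 0 := by
  ext c; simp [MvPolynomial.coeff_divMonomial]

theorem contract_add_right (f a b : MvPolynomial (Fin n) k) :
    contract k n f (a + b) = contract k n f a + contract k n f b := by
  simp [contract, divMonomial_add, smul_add, Finset.sum_add_distrib]

theorem contract_smul_right (f : MvPolynomial (Fin n) k) (r : k) (a : MvPolynomial (Fin n) k) :
    contract k n f (r • a) = r • contract k n f a := by
  simp only [contract, divMonomial_smul]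
  rw [Finset.smul_sum]
  exact Finset.sum_congr rfl fun d _ => smul_comm _ _ _

theorem contract_zero_right (f : MvPolynomial (Fin n) k) : contract k n f 0 = 0 := by
  simp [contract, divMonomial_zero]

/-- The degree `-d` graded piece of the Macaulay inverse system `I^⊥ ⊆ S`:
homogeneous dual polynomials of degree `d` annihilated by `I` under contraction. -/
def perpSub (I : Ideal (MvPolynomial (Fin n) k)) (d : ℕ) :
    Submodule k (MvPolynomial (Fin n) k) where
  carrier := {g | g ∈ homogeneousSubmodule (Fin n) k d ∧ ∀ f ∈ I, contract k n f g = 0}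
  add_mem' := by
    rintro a b ⟨ha1, ha2⟩ ⟨hb1, hb2⟩
    exact ⟨Submodule.add_mem _ ha1 hb1, fun f hf => by
      rw [contract_add_right, ha2 f hf, hb2 f hf, add_zero]⟩
  zero_mem' := ⟨Submodule.zero_mem _, fun f _ => contract_zero_right k n f⟩
  smul_mem' := by
    rintro c a ⟨ha1, ha2⟩
    exact ⟨Submodule.smul_mem _ c ha1, fun f hf => by
      rw [contract_smul_right, ha2 f hf, smul_zero]⟩

/-- The full Macaulay inverse system `I^⊥` as a subset of `S`. -/
def perpSet (I : Ideal (MvPolynomial (Fin n) k)) : Set (MvPolynomial (Fin n) k) :=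
  {g | ∀ f ∈ I, contract k n f g = 0}



/-- The degree `m` graded piece of `A = R/I`, as a `k`-subspace of the quotient. -/
def Agr (I : Ideal (MvPolynomial (Fin n) k)) (m : ℕ) :
    Submodule k (MvPolynomial (Fin n) k ⧸ I) :=
  (homogeneousSubmodule (Fin n) k m).map (Ideal.Quotient.mkₐ k I).toLinearMap

/-- The socle of `A = R/I`: elements annihilated by all the variables. -/
def socSub (I : Ideal (MvPolynomial (Fin n) k)) :
    Submodule k (MvPolynomial (Fin n) k ⧸ I) :=
  ⨅ j : Fin n, LinearMap.ker (LinearMap.mulLeft k (Ideal.Quotient.mk I (X j)))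

/-- `dim_k Soc(A)_j`. -/
def socdim (I : Ideal (MvPolynomial (Fin n) k)) (j : ℕ) : ℕ :=
  Module.finrank k ↥(Agr k n I j ⊓ socSub k n I)

/-- Hilbert function of `A = R/I`. -/
def hfA (I : Ideal (MvPolynomial (Fin n) k)) (i : ℕ) : ℕ :=
  Module.finrank k ↥(Agr k n I i)

/-- `dim_k R_i`. -/
def rdim (i : ℕ) : ℕ := Module.finrank k ↥(homogeneousSubmodule (Fin n) k i)

/-- The degree `i` graded piece of a homogeneous ideal `I`. -/
def Igrade (I : Ideal (MvPolynomial (Fin n) k)) (i : ℕ) :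
    Submodule k (MvPolynomial (Fin n) k) :=
  homogeneousSubmodule (Fin n) k i ⊓ Submodule.restrictScalars k I

/-- The initial degree `t(I)` of a homogeneous ideal. -/
def tdeg (I : Ideal (MvPolynomial (Fin n) k)) : ℕ := sInf {i | Igrade k n I i ≠ ⊥}

/-- The top socle degree `s(A)` of `A = R/I`. -/
def sdeg (I : Ideal (MvPolynomial (Fin n) k)) : ℕ :=
  sSup {i | Agr k n I i ⊓ socSub k n I ≠ ⊥}

/-- `I` is a homogeneous ideal. -/
def IsHomog (I : Ideal (MvPolynomial (Fin n) k)) : Prop :=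
  ∀ f ∈ I, ∀ m : ℕ, homogeneousComponent m f ∈ I

/-- `A = R/I` is a narrow algebra: an artinian graded quotient with `t(I) ≥ s(A)`. -/
def IsNarrow (I : Ideal (MvPolynomial (Fin n) k)) : Prop :=
  IsHomog k n I ∧ IsArtinianRing (MvPolynomial (Fin n) k ⧸ I) ∧ sdeg k n I ≤ tdeg k n I

/-- The homogeneous maximal ideal `m = (x_1,…,x_n)`. -/
def mIdeal : Ideal (MvPolynomial (Fin n) k) := Ideal.span (Set.range X)


section

variable {k n}

open Module

instance finite_homogeneousSubmodule (m : ℕ) :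
    Module.Finite k (homogeneousSubmodule (Fin n) k m) :=
  Module.Finite.iff_fg.mpr (homogeneousSubmodule_fg _ _ m)

instance finite_Agr (I : Ideal (MvPolynomial (Fin n) k)) (m : ℕ) :
    Module.Finite k (Agr k n I m) := by
  unfold Agr; infer_instance

variable {I : Ideal (MvPolynomial (Fin n) k)}

theorem mem_Agr {m : ℕ} {x : MvPolynomial (Fin n) k ⧸ I} :
    x ∈ Agr k n I m ↔ ∃ f, f.IsHomogeneous m ∧ Ideal.Quotient.mk I f = x := by
  simp [Agr, Submodule.mem_map]

theorem mul_mem_Agr {l m : ℕ} {x : MvPolynomial (Fin n) k ⧸ I} (hx : x ∈ Agr k n I m)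
    {r : MvPolynomial (Fin n) k} (hr : r.IsHomogeneous l) :
    Ideal.Quotient.mk I r * x ∈ Agr k n I (m + l) := by
  obtain ⟨f, hf, rfl⟩ := mem_Agr.mp hx
  exact mem_Agr.mpr ⟨r * f, by rw [add_comm]; exact hr.mul hf, map_mul _ _ _⟩

theorem mem_socSub {x : MvPolynomial (Fin n) k ⧸ I} :
    x ∈ socSub k n I ↔ ∀ j, Ideal.Quotient.mk I (X j) * x = 0 := by
  simp [socSub, Submodule.mem_iInf]

theorem finrank_comap_Igrade (m : ℕ) :
    finrank k ((Igrade k n I m).comap (homogeneousSubmodule (Fin n) k m).subtype) =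
      finrank k (Igrade k n I m) :=
  (Submodule.comapSubtypeEquivOfLe
    (show Igrade k n I m ≤ homogeneousSubmodule (Fin n) k m from inf_le_left)).finrank_eq

theorem hfA_add_finrank_Igrade (m : ℕ) :
    hfA k n I m + finrank k (Igrade k n I m) = rdim k n m := by
  have h := LinearMap.finrank_range_add_finrank_ker
    ((Ideal.Quotient.mkₐ k I).toLinearMap.domRestrict (homogeneousSubmodule (Fin n) k m))
  have hk : LinearMap.ker
      ((Ideal.Quotient.mkₐ k I).toLinearMap.domRestrict (homogeneousSubmodule (Fin n) k m)) =
      (Igrade k n I m).comap (homogeneousSubmodule (Fin n) k m).subtype := by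
    ext f
    simp [Igrade, Ideal.Quotient.eq_zero_iff_mem]
  rw [LinearMap.range_domRestrict, hk, finrank_comap_Igrade] at h
  exact h

theorem Igrade_eq_bot {m : ℕ} (hm : m < tdeg k n I) : Igrade k n I m = ⊥ := by
  simpa using Nat.notMem_of_lt_sInf hm

theorem exists_Agr_eq_bot (hI : IsHomog k n I)
    (hA : IsArtinianRing (MvPolynomial (Fin n) k ⧸ I)) :
    ∃ N, ∀ m, N ≤ m → Agr k n I m = ⊥ := by
  let M := idealOfVars (Fin n) k
  obtain ⟨N, hN⟩ := IsArtinian.monotone_stabilizes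
    (⟨fun m => OrderDual.toDual ((M ^ m).map (Ideal.Quotient.mk I)), fun a b hab =>
      Ideal.map_mono (Ideal.pow_le_pow_right hab)⟩ :
      ℕ →o (Submodule (MvPolynomial (Fin n) k ⧸ I) (MvPolynomial (Fin n) k ⧸ I))ᵒᵈ)
  refine ⟨N, fun m hm => (Submodule.eq_bot_iff _).mpr fun x hx => ?_⟩
  obtain ⟨f, hf, rfl⟩ := mem_Agr.mp hx
  have hfM : f ∈ M ^ m := (mem_pow_idealOfVars_iff' _ _).mpr fun e he => hf.coeff_eq_zero he.ne
  have h1 : (M ^ m).map (Ideal.Quotient.mk I) = (M ^ (m + 1)).map (Ideal.Quotient.mk I) :=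
    OrderDual.toDual.injective ((hN m hm).symm.trans (hN (m + 1) (by omega)))
  have h2 := Ideal.mem_map_of_mem (Ideal.Quotient.mk I) hfM
  rw [h1, Ideal.mem_map_iff_of_surjective _ Ideal.Quotient.mk_surjective] at h2
  obtain ⟨g, hg, hgf⟩ := h2
  rw [eq_comm, Ideal.Quotient.eq] at hgf
  have h3 := hI _ hgf m
  rw [map_sub, homogeneousComponent_eq_self hf, homogeneousComponent_eq_zero', sub_zero] at h3
  · exact Ideal.Quotient.eq_zero_iff_mem.mpr h3
  · intro e he
    have := (mem_pow_idealOfVars_iff _ _).mp hg e he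
    omega

theorem le_sdeg {N : ℕ} (hN : ∀ m, N ≤ m → Agr k n I m = ⊥) {j : ℕ}
    {x : MvPolynomial (Fin n) k ⧸ I} (hx : x ∈ Agr k n I j ⊓ socSub k n I) (hx0 : x ≠ 0) :
    j ≤ sdeg k n I := by
  refine le_csSup ⟨N, fun i hi => ?_⟩ ((Submodule.ne_bot_iff _).mpr ⟨x, hx, hx0⟩)
  by_contra! h
  exact hi (by rw [hN i h.le, bot_inf_eq])

/-- Every nonzero homogeneous element has a nonzero homogeneous multiple in the socle. -/
theorem exists_mul_mem_socSub {N : ℕ} (hN : ∀ m, N ≤ m → Agr k n I m = ⊥) {i : ℕ}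
    {x : MvPolynomial (Fin n) k ⧸ I} (hx : x ∈ Agr k n I i) (hx0 : x ≠ 0) :
    ∃ (l : ℕ) (r : MvPolynomial (Fin n) k), r.IsHomogeneous l ∧
      Ideal.Quotient.mk I r * x ≠ 0 ∧
      Ideal.Quotient.mk I r * x ∈ Agr k n I (i + l) ⊓ socSub k n I := by
  let P : ℕ → Prop := fun l => ∃ r : MvPolynomial (Fin n) k, r.IsHomogeneous l ∧
    Ideal.Quotient.mk I r * x ≠ 0
  have hP0 : P 0 := ⟨1, isHomogeneous_one _ _, by simpa using hx0⟩
  have hPN : ∀ l, P l → l ≤ N := by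
    rintro l ⟨r, hr, h⟩
    by_contra! hl
    have := mul_mem_Agr hx hr
    rw [hN _ (by omega)] at this
    exact h this
  obtain ⟨r, hr, h⟩ := Nat.findGreatest_spec (P := P) (Nat.zero_le N) hP0
  refine ⟨_, r, hr, h, mul_mem_Agr hx hr, mem_socSub.mpr fun j => ?_⟩
  by_contra hj
  have hP : P (1 + Nat.findGreatest P N) :=
    ⟨X j * r, (isHomogeneous_X _ _).mul hr, by rwa [map_mul, mul_assoc]⟩
  have := Nat.le_findGreatest (hPN _ hP) hP
  omega

theorem Agr_eq_bot_of_sdeg_lt {N : ℕ} (hN : ∀ m, N ≤ m → Agr k n I m = ⊥) {i : ℕ}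
    (hi : sdeg k n I < i) : Agr k n I i = ⊥ := by
  refine (Submodule.eq_bot_iff _).mpr fun x hx => ?_
  by_contra hx0
  obtain ⟨l, r, -, h0, h⟩ := exists_mul_mem_socSub hN hx hx0
  have := le_sdeg hN h h0
  omega

theorem hfA_le_sum_socdim {N : ℕ} (hN : ∀ m, N ≤ m → Agr k n I m = ⊥) (i : ℕ) :
    hfA k n I i ≤ ∑ j ∈ Finset.Icc i (sdeg k n I), socdim k n I j * rdim k n (j - i) := by
  let A := MvPolynomial (Fin n) k ⧸ I
  let soc : ℕ → Submodule k A := fun j => Agr k n I j ⊓ socSub k n I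
  have hproj : ∀ j, ∃ p : A →ₗ[k] soc j, p ∘ₗ (soc j).subtype = LinearMap.id := fun j =>
    LinearMap.exists_leftInverse_of_injective _ (soc j).ker_subtype
  choose p hp using hproj
  let J := Finset.Icc i (sdeg k n I)
  let φ : Agr k n I i →ₗ[k]
      ((j : J) → homogeneousSubmodule (Fin n) k (j - i) →ₗ[k] soc j) :=
    LinearMap.pi fun j =>
      ((LinearMap.llcomp k _ A (soc j) (p j)) ∘ₗ
        (LinearMap.lcomp k A ((Ideal.Quotient.mkₐ k I).toLinearMap ∘ₗ
          (homogeneousSubmodule (Fin n) k (j - i)).subtype)) ∘ₗ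
        (LinearMap.mul k A)) ∘ₗ (Agr k n I i).subtype
  have hφ : Function.Injective φ := by
    refine (injective_iff_map_eq_zero φ).mpr ?_
    rintro ⟨x, hx⟩ h
    by_contra hx0
    have hx0 : x ≠ 0 := fun h0 => hx0 (Subtype.ext h0)
    obtain ⟨l, r, hr, hrx0, hrx⟩ := exists_mul_mem_socSub hN hx hx0
    have hj : i + l ∈ J := Finset.mem_Icc.mpr ⟨by omega, le_sdeg hN hrx hrx0⟩
    have hr' : r ∈ homogeneousSubmodule (Fin n) k (i + l - i) := by
      rw [Nat.add_sub_cancel_left]; exact hr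
    have h1 : p (i + l) (x * Ideal.Quotient.mk I r) = 0 :=
      LinearMap.congr_fun (congr_fun h ⟨i + l, hj⟩) ⟨r, hr'⟩
    have h2 := LinearMap.congr_fun (hp (i + l)) ⟨_, hrx⟩
    rw [mul_comm] at h1
    have h3 : (0 : soc (i + l)) = ⟨_, hrx⟩ := h1.symm.trans h2
    exact hrx0 (congr_arg Subtype.val h3).symm
  have hfin : ∀ j, Module.Finite k (soc j) := fun j =>
    Submodule.finiteDimensional_of_le (inf_le_left : soc j ≤ Agr k n I j)
  have hfin' : ∀ j : J,
      Module.Finite k (homogeneousSubmodule (Fin n) k (j - i) →ₗ[k] soc j) := fun j =>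
    haveI := hfin j
    Module.Finite.linearMap _ _ _ _
  calc hfA k n I i ≤ _ := LinearMap.finrank_le_finrank_of_injective hφ
    _ = ∑ j : J, socdim k n I j * rdim k n (j - i) := by
      rw [Module.finrank_pi_fintype]
      exact Finset.sum_congr rfl fun j _ => by
        rw [Module.finrank_linearMap, mul_comm]; rfl
    _ = _ := Finset.sum_coe_sort J fun j => socdim k n I j * rdim k n (j - i)

theorem mem_degreeSet {d : ℕ} {m : Fin n →₀ ℕ} :
    m ∈ Finset.finsuppAntidiag Finset.univ d ↔ m.degree = d := by
  simp [Finset.mem_finsuppAntidiag, Finsupp.degree_eq_sum]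

/-- The symmetric bilinear form on `R_d` for which the monomials are orthonormal. -/
def coeffForm (k : Type) [Field k] (n d : ℕ) :
    LinearMap.BilinForm k (homogeneousSubmodule (Fin n) k d) :=
  LinearMap.mk₂ k
    (fun f g => ∑ m ∈ Finset.finsuppAntidiag Finset.univ d, coeff m f.1 * coeff m g.1)
    (by intros; simp [add_mul, Finset.sum_add_distrib])
    (by intros; simp [Finset.mul_sum, mul_assoc])
    (by intros; simp [mul_add, Finset.sum_add_distrib])
    (by intros; simp [Finset.mul_sum, mul_left_comm])

theorem coeffForm_apply {d : ℕ} (f g : homogeneousSubmodule (Fin n) k d) :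
    coeffForm k n d f g =
      ∑ m ∈ Finset.finsuppAntidiag Finset.univ d, coeff m f.1 * coeff m g.1 := rfl

theorem coeffForm_comm {d : ℕ} (f g : homogeneousSubmodule (Fin n) k d) :
    coeffForm k n d f g = coeffForm k n d g f := by
  simp only [coeffForm_apply, mul_comm]

theorem coeffForm_nondegenerate (d : ℕ) : (coeffForm k n d).Nondegenerate := by
  have h : ∀ f, (∀ g, coeffForm k n d f g = 0) → f = 0 := by
    intro f hf
    ext m
    by_cases hm : m.degree = d
    · have := hf ⟨monomial m 1, isHomogeneous_monomial _ hm⟩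
      simpa [coeffForm_apply, coeff_monomial, mem_degreeSet.mpr hm] using this
    · exact IsHomogeneous.coeff_eq_zero f.2 hm
  exact ⟨h, fun g hg => h g fun f => by rw [coeffForm_comm, hg]⟩

theorem coeff_contract (f g : MvPolynomial (Fin n) k) (c : Fin n →₀ ℕ) :
    coeff c (contract k n f g) = ∑ e ∈ f.support, coeff e f * coeff (e + c) g := by
  simp [contract, coeff_sum, coeff_divMonomial]

/-- The coefficients of `f ∘ g` are values of the pairing at monomial multiples of `f`. -/
theorem coeff_contract_of_isHomogeneous {d : ℕ} (f : MvPolynomial (Fin n) k)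
    (g : homogeneousSubmodule (Fin n) k d) (c : Fin n →₀ ℕ) :
    coeff c (contract k n f g.1) = coeffForm k n d
      ⟨homogeneousComponent d (f * monomial c 1), homogeneousComponent_mem _ _⟩ g := by
  rw [coeff_contract, coeffForm_apply]
  refine Finset.sum_bij_ne_zero (fun e _ _ => e + c) (fun e _ he => ?_)
    (fun _ _ _ _ _ _ h => add_right_cancel h) (fun m hm h => ?_) (fun e _ he => ?_)
  · rw [mem_degreeSet]
    by_contra hd
    exact he (by rw [IsHomogeneous.coeff_eq_zero g.2 hd, mul_zero])
  · rw [coeff_homogeneousComponent, if_pos (mem_degreeSet.mp hm), coeff_mul_monomial'] at h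
    by_cases hcm : c ≤ m
    · rw [if_pos hcm, mul_one] at h
      refine ⟨m - c, ?_, ?_, tsub_add_cancel_of_le hcm⟩
      · exact mem_support_iff.mpr (left_ne_zero_of_mul h)
      · rwa [tsub_add_cancel_of_le hcm]
    · simp [hcm] at h
  · have hd : (e + c).degree = d := by
      by_contra hd
      exact he (by rw [IsHomogeneous.coeff_eq_zero g.2 hd, mul_zero])
    rw [coeff_homogeneousComponent, if_pos hd, coeff_mul_monomial, mul_one]

theorem perpSub_eq_map_orthogonal (hI : IsHomog k n I) (d : ℕ) :
    perpSub k n I d = ((coeffForm k n d).orthogonal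
      ((Igrade k n I d).comap (homogeneousSubmodule (Fin n) k d).subtype)).map
        (homogeneousSubmodule (Fin n) k d).subtype := by
  ext g
  constructor
  · rintro ⟨hg, h⟩
    refine ⟨⟨g, hg⟩, fun f hf => ?_, rfl⟩
    have := coeff_contract_of_isHomogeneous f.1 ⟨g, hg⟩ 0
    simp only [monomial_zero', map_one, mul_one, homogeneousComponent_eq_self f.2] at this
    exact this.symm.trans (by rw [h f.1 hf.2, coeff_zero])
  · rintro ⟨g, hg, rfl⟩
    refine ⟨g.2, fun f hf => ?_⟩
    ext c
    rw [Submodule.subtype_apply, coeff_contract_of_isHomogeneous, coeff_zero]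
    exact hg _ ⟨homogeneousComponent_mem _ _, hI _ (I.mul_mem_right _ hf) _⟩

theorem finrank_perpSub (hI : IsHomog k n I) (d : ℕ) :
    finrank k (perpSub k n I d) = hfA k n I d := by
  rw [perpSub_eq_map_orthogonal hI, Submodule.finrank_map_subtype_eq,
    LinearMap.BilinForm.finrank_orthogonal (coeffForm_nondegenerate d),
    finrank_comap_Igrade]
  exact Nat.sub_eq_of_eq_add (hfA_add_finrank_Igrade d).symm

theorem rdim_zero_le : rdim k n 0 ≤ 1 := by
  rw [rdim, homogeneousSubmodule_zero, Submodule.one_eq_span]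
  simpa using finrank_span_le_card (R := k) ({1} : Set (MvPolynomial (Fin n) k))

end

/-- A narrow artinian quotient `A = R/I` with `s(A) = d` and `dim_k (I^⊥)_{-d} = a ≥ 1`
is compressed and has Hilbert function `HF_A(i) = dim_k R_i` for `i ≤ d-1`,
`HF_A(d) = a` and `HF_A(i) = 0` for `i > d`. -/
theorem stmt5 (d a : ℕ) (hd : 1 ≤ d) (ha : 1 ≤ a)
    (I : Ideal (MvPolynomial (Fin n) k))
    (hnarrow : IsNarrow k n I) (hs : sdeg k n I = d)
    (hperp : Module.finrank k ↥(perpSub k n I d) = a) :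
    (∀ i, i ≤ d - 1 → hfA k n I i = rdim k n i) ∧
    hfA k n I d = a ∧
    (∀ i, d < i → hfA k n I i = 0) ∧
    (∀ i, i ≤ sdeg k n I → hfA k n I i =
      min (rdim k n i)
        (∑ j ∈ Finset.Icc i (sdeg k n I), socdim k n I j * rdim k n (j - i))) := by
  obtain ⟨hI, hA, hst⟩ := hnarrow
  obtain ⟨N, hN⟩ := exists_Agr_eq_bot hI hA
  have hlow : ∀ i, i < d → hfA k n I i = rdim k n i := fun i hi => by
    have := hfA_add_finrank_Igrade (I := I) i
    rwa [Igrade_eq_bot (by omega), finrank_bot, add_zero] at this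
  refine ⟨fun i hi => hlow i (by omega), ?_, fun i hi => ?_, fun i hi => ?_⟩
  · rw [← finrank_perpSub hI, hperp]
  · rw [hfA, Agr_eq_bot_of_sdeg_lt hN (by omega), finrank_bot]
  · have hsum := hfA_le_sum_socdim hN i
    have hle : hfA k n I i ≤ rdim k n i := by
      have := hfA_add_finrank_Igrade (I := I) i
      omega
    refine le_antisymm (le_min hle hsum) ?_
    rcases (hs ▸ hi).lt_or_eq with hid | rfl
    · exact (min_le_left _ _).trans (hlow i hid).ge
    · refine (min_le_right _ _).trans ?_
      rw [hs, Finset.Icc_self, Finset.sum_singleton, Nat.sub_self]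
      calc _ ≤ socdim k n I i * 1 := Nat.mul_le_mul_left _ rdim_zero_le
        _ ≤ _ := by rw [mul_one]; exact Submodule.finrank_mono inf_le_left

end PSI
end
end

section
/- Let A = R/I be a narrow artinian quotient of R = k[x_1,...,x_n] with s(A) = d and dim_k (I^⊥)_{-d} = a ≥ 1. Then t(I) ∈ {d, d+1}, and the following are equivalent: t(I) = d+1; I = m^{d+1}; a = dim_k R_d. -/
open MvPolynomial

noncomputable section
namespace PSI

open scoped Classical

variable (k : Type) [Field k] (n : ℕ)

variable {k n}

theorem mem_mIdeal_pow_iff (N : ℕ) (f : MvPolynomial (Fin n) k) :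
    f ∈ mIdeal k n ^ N ↔ ∀ e : Fin n →₀ ℕ, e.degree < N → f.coeff e = 0 :=
  mem_pow_idealOfVars_iff' N f

theorem mem_mIdeal_pow_of_isHomogeneous {f : MvPolynomial (Fin n) k} {i N : ℕ}
    (hf : f.IsHomogeneous i) (h : N ≤ i) : f ∈ mIdeal k n ^ N :=
  (mem_mIdeal_pow_iff N f).2 fun _ he => hf.coeff_eq_zero (by omega)

theorem mem_Igrade {I : Ideal (MvPolynomial (Fin n) k)} {i : ℕ} {f : MvPolynomial (Fin n) k} :
    f ∈ Igrade k n I i ↔ f.IsHomogeneous i ∧ f ∈ I := Iff.rfl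

/-- If `R/I` is artinian and graded, then `I` contains all forms of large degree. -/
theorem exists_forall_isHomogeneous_mem {I : Ideal (MvPolynomial (Fin n) k)}
    (hI : IsHomog k n I) (hA : IsArtinianRing (MvPolynomial (Fin n) k ⧸ I)) :
    ∃ N, ∀ i, N ≤ i → ∀ f : MvPolynomial (Fin n) k, f.IsHomogeneous i → f ∈ I := by
  let J := (mIdeal k n).map (Ideal.Quotient.mk I)
  obtain ⟨N, hN⟩ := IsArtinian.monotone_stabilizes
    (⟨fun i => OrderDual.toDual (J ^ i), fun _ _ h => Ideal.pow_le_pow_right h⟩ :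
      ℕ →o (Submodule (MvPolynomial (Fin n) k ⧸ I) (MvPolynomial (Fin n) k ⧸ I))ᵒᵈ)
  have hN' : ∀ i, N ≤ i → J ^ N = J ^ i := fun i hi => hN i hi
  refine ⟨N, fun i hi f hf => ?_⟩
  have hmem : Ideal.Quotient.mk I f ∈ (mIdeal k n ^ (i + 1)).map (Ideal.Quotient.mk I) := by
    rw [Ideal.map_pow, ← hN' (i + 1) (by omega), hN' i hi, ← Ideal.map_pow]
    exact Ideal.mem_map_of_mem _ (mem_mIdeal_pow_of_isHomogeneous hf le_rfl)
  obtain ⟨u, hu, huf⟩ :=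
    (Ideal.mem_map_iff_of_surjective _ Ideal.Quotient.mk_surjective).1 hmem
  have hfu : f - u ∈ I := Ideal.Quotient.eq.1 huf.symm
  have hui : homogeneousComponent i u = 0 := by
    ext e
    rw [coeff_homogeneousComponent, coeff_zero]
    split_ifs with he
    · exact (mem_mIdeal_pow_iff _ _).1 hu e (by omega)
    · rfl
  have := hI _ hfu i
  rwa [map_sub, hui, sub_zero, homogeneousComponent_eq_self hf] at this

/-- Above the top socle degree, a graded artinian quotient vanishes. -/
theorem mem_of_sdeg_lt {I : Ideal (MvPolynomial (Fin n) k)}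
    (hI : IsHomog k n I) (hA : IsArtinianRing (MvPolynomial (Fin n) k ⧸ I))
    {i : ℕ} (hi : sdeg k n I < i) {f : MvPolynomial (Fin n) k} (hf : f.IsHomogeneous i) :
    f ∈ I := by
  obtain ⟨N, hN⟩ := exists_forall_isHomogeneous_mem hI hA
  have hbdd : BddAbove {i | Agr k n I i ⊓ socSub k n I ≠ ⊥} := by
    refine ⟨N, fun j hj => ?_⟩
    by_contra! hlt
    refine hj (eq_bot_iff.2 ?_)
    rintro _ ⟨⟨g, hg, rfl⟩, -⟩
    exact Ideal.Quotient.eq_zero_iff_mem.2 (hN j hlt.le g hg)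
  obtain hle | hlt := le_total N i
  · exact hN i hle f hf
  induction hlt using Nat.decreasingInduction generalizing f with
  | self => exact hN N le_rfl f hf
  | of_succ j _ ih =>
    have hbot : Agr k n I j ⊓ socSub k n I = ⊥ := by
      by_contra hne
      exact absurd (le_csSup hbdd hne) (not_le.2 hi)
    have hmem : Ideal.Quotient.mk I f ∈ Agr k n I j ⊓ socSub k n I := by
      refine ⟨⟨f, hf, rfl⟩, ?_⟩
      simp only [socSub, SetLike.mem_coe, Submodule.mem_iInf, LinearMap.mem_ker,
        LinearMap.mulLeft_apply]
      intro l
      rw [← map_mul, Ideal.Quotient.eq_zero_iff_mem]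
      refine ih (by omega) ?_
      rw [add_comm]
      exact (isHomogeneous_X k l).mul hf
    rw [hbot, Submodule.mem_bot] at hmem
    exact Ideal.Quotient.eq_zero_iff_mem.1 hmem

theorem le_mIdeal_pow_of_le_tdeg {I : Ideal (MvPolynomial (Fin n) k)} (hI : IsHomog k n I)
    {N : ℕ} (hN : N ≤ tdeg k n I) : I ≤ mIdeal k n ^ N := by
  refine fun f hf => (mem_mIdeal_pow_iff N f).2 fun e he => ?_
  have hbot : Igrade k n I e.degree = ⊥ := by
    by_contra hne
    exact absurd (Nat.sInf_le hne) (not_le.2 (he.trans_le hN))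
  have hmem : homogeneousComponent e.degree f ∈ Igrade k n I e.degree :=
    mem_Igrade.2 ⟨homogeneousComponent_isHomogeneous _ _, hI f hf _⟩
  rw [hbot, Submodule.mem_bot] at hmem
  simpa [coeff_homogeneousComponent] using congrArg (coeff e) hmem

theorem mIdeal_pow_le {I : Ideal (MvPolynomial (Fin n) k)} {N : ℕ}
    (h : ∀ i, N ≤ i → ∀ f : MvPolynomial (Fin n) k, f.IsHomogeneous i → f ∈ I) :
    mIdeal k n ^ N ≤ I := by
  intro f hf
  rw [f.as_sum]
  refine Ideal.sum_mem _ fun e he => h e.degree ?_ _ (isHomogeneous_monomial _ rfl)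
  by_contra! hlt
  exact mem_support_iff.1 he ((mem_mIdeal_pow_iff N f).1 hf e hlt)

theorem contract_eq_zero_of_mem_mIdeal_pow {f g : MvPolynomial (Fin n) k} {d : ℕ}
    (hf : f ∈ mIdeal k n ^ (d + 1)) (hg : g.IsHomogeneous d) : contract k n f g = 0 := by
  refine Finset.sum_eq_zero fun e he => ?_
  have hde : d < e.degree := by
    by_contra! hle
    exact mem_support_iff.1 he ((mem_mIdeal_pow_iff _ f).1 hf e (by omega))
  have : g.divMonomial e = 0 := by
    ext c
    rw [coeff_divMonomial, coeff_zero]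
    exact hg.coeff_eq_zero (by rw [map_add]; omega)
  rw [this, smul_zero]

/-- On forms of equal degree, contraction is the coefficient pairing. -/
theorem coeff_zero_contract_monomial (f : MvPolynomial (Fin n) k) (e : Fin n →₀ ℕ) :
    coeff 0 (contract k n f (monomial e 1)) = coeff e f := by
  simp only [contract, coeff_sum, coeff_smul, coeff_divMonomial, add_zero, coeff_monomial,
    smul_eq_mul, mul_ite, mul_one, mul_zero]
  rw [Finset.sum_ite_eq]
  simp +contextual [eq_comm]

variable (k n)

/-- For a narrow artinian quotient `A = R/I` with `s(A) = d` and `dim_k (I^⊥)_{-d} = a ≥ 1`: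
`t(I) ∈ {d, d+1}`, and `t(I) = d+1 ↔ I = m^{d+1} ↔ a = dim_k R_d`. -/
theorem stmt6 (d a : ℕ) (hd : 1 ≤ d) (ha : 1 ≤ a)
    (I : Ideal (MvPolynomial (Fin n) k))
    (hnarrow : IsNarrow k n I) (hs : sdeg k n I = d)
    (hperp : Module.finrank k ↥(perpSub k n I d) = a) :
    (tdeg k n I = d ∨ tdeg k n I = d + 1) ∧
    (tdeg k n I = d + 1 ↔ I = (mIdeal k n) ^ (d + 1)) ∧
    (tdeg k n I = d + 1 ↔ a = rdim k n d) := by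
  obtain ⟨hI, hA, hst⟩ := hnarrow
  rw [hs] at hst
  have hvanish : ∀ i, d + 1 ≤ i → ∀ f : MvPolynomial (Fin n) k, f.IsHomogeneous i → f ∈ I :=
    fun i hi f hf => mem_of_sdeg_lt hI hA (by omega) hf
  obtain ⟨j⟩ : Nonempty (Fin n) := by
    by_contra hempty
    rw [not_nonempty_iff] at hempty
    have hbot : perpSub k n I d = ⊥ := by
      refine eq_bot_iff.2 fun g hg => ?_
      by_contra hne
      have := (isHomogeneous_of_isEmpty (f := g)).inj_right hg.1 hne
      omega
    rw [hbot, finrank_bot] at hperp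
    omega
  have hmem : d + 1 ∈ {i | Igrade k n I i ≠ ⊥} := by
    have hX := isHomogeneous_X_pow (R := k) j (d + 1)
    exact fun hbot => pow_ne_zero (d + 1) (X_ne_zero (R := k) j)
      ((Submodule.eq_bot_iff _).1 hbot _ (mem_Igrade.2 ⟨hX, hvanish _ le_rfl _ hX⟩))
  have hle : tdeg k n I ≤ d + 1 := Nat.sInf_le hmem
  have hdich : tdeg k n I = d ∨ tdeg k n I = d + 1 := by omega
  have hform : tdeg k n I = d → ∃ f ∈ I, ∃ e : Fin n →₀ ℕ, e.degree = d ∧ coeff e f ≠ 0 := by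
    intro ht
    have hne : Igrade k n I (tdeg k n I) ≠ ⊥ := Nat.sInf_mem ⟨_, hmem⟩
    obtain ⟨f, hf, hf0⟩ := Submodule.exists_mem_ne_zero_of_ne_bot hne
    rw [ht, mem_Igrade] at hf
    obtain ⟨e, he⟩ := ne_zero_iff.1 hf0
    exact ⟨f, hf.2, e, by_contra fun h => he (hf.1.coeff_eq_zero h), he⟩
  refine ⟨hdich, ⟨fun ht => ?_, fun hIm => ?_⟩, ⟨fun ht => ?_, fun had => ?_⟩⟩
  · exact le_antisymm (le_mIdeal_pow_of_le_tdeg hI ht.ge) (mIdeal_pow_le hvanish)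
  · refine hdich.resolve_left fun ht => ?_
    obtain ⟨f, hf, e, hed, he⟩ := hform ht
    rw [hIm] at hf
    exact he ((mem_mIdeal_pow_iff _ f).1 hf e (by omega))
  · have : perpSub k n I d = homogeneousSubmodule (Fin n) k d :=
      le_antisymm (fun _ hg => hg.1) fun _ hg => ⟨hg, fun _ hf =>
        contract_eq_zero_of_mem_mIdeal_pow (le_mIdeal_pow_of_le_tdeg hI ht.ge hf) hg⟩
    rw [← hperp, this, rdim]
  · refine hdich.resolve_left fun ht => ?_
    obtain ⟨f, hf, e, hed, he⟩ := hform ht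
    have : Module.Finite k (homogeneousSubmodule (Fin n) k d) :=
      Module.Finite.iff_fg.2 (homogeneousSubmodule_fg (Fin n) k d)
    have heq : perpSub k n I d = homogeneousSubmodule (Fin n) k d :=
      Submodule.eq_of_le_of_finrank_eq (fun _ hg => hg.1) (hperp.trans had)
    have hmon : monomial e (1 : k) ∈ perpSub k n I d := heq ▸ isHomogeneous_monomial 1 hed
    rw [← coeff_zero_contract_monomial, hmon.2 f hf, coeff_zero] at he
    exact he rfl

end PSI
end
end

section
/- Let d ≥ 2, n > 3d, char(k) ≠ 2, and let f ∈ k[x_1,...,x_n] be the polynomial f = x_1^d + Σ_{λ⊢d, λ≠(d)} Σ_{γ⊊λ} b(λ,γ) constructed from admissible binomials with pairwise disjoint variable supports. Then the principal symmetric ideal I = (f)_{S_n} satisfies dim_k I_d = dim_k R_d − (P(d) − 1), where P(d) is the number of partitions of d. -/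
open MvPolynomial

noncomputable section
namespace PSI

open scoped Classical

variable (k : Type) [Field k] (n : ℕ)



/-- The principal symmetric ideal `(f)_{S_n}` generated by the orbit of `f` under the
symmetric group permuting the variables. -/
def psi (f : MvPolynomial (Fin n) k) : Ideal (MvPolynomial (Fin n) k) :=
  Ideal.span {g | ∃ σ : Equiv.Perm (Fin n), g = rename σ f}

/-- Index type for the coordinates on the parameter space of degree-`d` forms:
exponent vectors of total degree `d`. -/
def DegMon (d : ℕ) : Type := {m : Fin n →₀ ℕ // (m.sum fun _ e => e) = d}

/-- "A general principal symmetric ideal generated in degree `d` satisfies `P`":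
there is a nonzero polynomial `h` in the coefficients (i.e. a nonempty Zariski-open
subset of the parameter space `P^{N-1}`) such that `(f)_{S_n}` satisfies `P` whenever
the coefficient vector of the degree-`d` form `f` does not lie on the hypersurface `h = 0`. -/
def GeneralPSI (d : ℕ) (P : Ideal (MvPolynomial (Fin n) k) → Prop) : Prop :=
  ∃ h : MvPolynomial (DegMon n d) k, h ≠ 0 ∧
    ∀ f ∈ homogeneousSubmodule (Fin n) k d,
      eval (fun m => coeff m.1 f) h ≠ 0 → P (psi k n f)

/-- `P(d)`, the number of partitions of `d`. -/
def Pnum (d : ℕ) : ℕ := Fintype.card (Nat.Partition d)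

/-- total degree (weight) of an exponent vector. -/
def wt (m : Fin n →₀ ℕ) : ℕ := m.sum fun _ e => e

/-- The type of a monomial: the multiset of its nonzero exponents (a partition of its degree). -/
def typeOf (m : Fin n →₀ ℕ) : Multiset ℕ := m.support.val.map m

/-- The finite set of exponent vectors of total degree `d`. -/
def expFinset (d : ℕ) : Finset (Fin n →₀ ℕ) :=
  ((Finset.univ : Finset (Fin n → Fin (d + 1))).image
    (fun v => Finsupp.equivFunOnFinite.symm fun i => (v i : ℕ))).filter
      (fun e => wt n e = d)

/-- The monomial symmetric polynomial `m_λ` (of degree `d = λ.sum`): the sum of all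
monomials of type `λ`. -/
def msym (d : ℕ) (lam : Multiset ℕ) : MvPolynomial (Fin n) k :=
  ∑ e ∈ (expFinset n d).filter (fun e => typeOf n e = lam), monomial e 1

/-- The index set for the binomials `b(λ,γ)` of Construction `c:f`: pairs `(λ, γ)` where
`λ ⊢ d` is a partition of `d` with `λ ≠ (d)` (a multiset of positive parts summing to `d`)
and `γ ⊊ λ` is a proper subpartition. -/
def PairSet (d : ℕ) : Set (Multiset ℕ × Multiset ℕ) :=
  {p | p.1.sum = d ∧ (∀ x ∈ p.1, 0 < x) ∧ p.1 ≠ {d} ∧ p.2 < p.1}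

theorem exists_perm_of_map_univ_eq {α β : Type*} [Fintype α] (f g : α → β)
    (h : (Finset.univ : Finset α).val.map f = (Finset.univ : Finset α).val.map g) :
    ∃ σ : Equiv.Perm α, ∀ a, g (σ a) = f a := by
  have key : ∀ c, Nonempty ({a // f a = c} ≃ {b // g b = c}) := by
    intro c
    have h1 := congrArg (Multiset.count c) h
    rw [Multiset.count_map, Multiset.count_map] at h1
    refine Fintype.card_eq.mp ?_
    rw [Fintype.card_subtype, Fintype.card_subtype, Finset.card, Finset.card,
      Finset.filter_val, Finset.filter_val]
    simpa only [eq_comm] using h1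
  exact ⟨Equiv.ofFiberEquiv fun c => (key c).some, fun a => Equiv.ofFiberEquiv_map _ a⟩

theorem typeOf_card (m : Fin n →₀ ℕ) : (typeOf n m).card = m.support.card := by
  simp [typeOf]

theorem typeOf_sum (m : Fin n →₀ ℕ) : (typeOf n m).sum = wt n m := rfl

theorem typeOf_pos (m : Fin n →₀ ℕ) : ∀ x ∈ typeOf n m, 0 < x := by
  intro x hx
  obtain ⟨i, hi, rfl⟩ := Multiset.mem_map.mp hx
  exact Nat.pos_of_ne_zero (Finsupp.mem_support_iff.mp hi)

theorem wt_eq_degree (m : Fin n →₀ ℕ) : wt n m = m.degree := rfl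

theorem map_univ_triple {α : Type*} (u v : Fin n →₀ ℕ) (hd : Disjoint u.support v.support)
    (w : Fin n → α) (c : α) (hw : ∀ i ∈ u.support ∪ v.support, w i = c) :
    (Finset.univ : Finset (Fin n)).val.map (fun i => (u i, v i, w i)) =
      (typeOf n u).map (fun a => (a, 0, c)) + (typeOf n v).map (fun a => (0, a, c)) +
      (Finset.univ \ (u.support ∪ v.support)).val.map (fun i => (0, 0, w i)) := by
  have h1 : (Finset.univ : Finset (Fin n)).val =
      u.support.val + v.support.val + (Finset.univ \ (u.support ∪ v.support)).val := by
    rw [← Finset.disjUnion_val _ _ hd, Finset.disjUnion_eq_union,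
      ← Finset.disjUnion_val _ _ Finset.disjoint_sdiff, Finset.disjUnion_eq_union,
      Finset.union_sdiff_of_subset (Finset.subset_univ _)]
  rw [h1, Multiset.map_add, Multiset.map_add, typeOf, typeOf, Multiset.map_map, Multiset.map_map]
  congr 1
  · congr 1
    · refine Multiset.map_congr rfl fun i hi => ?_
      have hi' : i ∈ u.support := hi
      have : v i = 0 := Finsupp.notMem_support_iff.mp (Finset.disjoint_left.mp hd hi')
      simp [this, hw i (Finset.mem_union_left _ hi')]
    · refine Multiset.map_congr rfl fun i hi => ?_
      have hi' : i ∈ v.support := hi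
      have : u i = 0 := Finsupp.notMem_support_iff.mp (Finset.disjoint_right.mp hd hi')
      simp [this, hw i (Finset.mem_union_right _ hi')]
  · refine Multiset.map_congr rfl fun i hi => ?_
    have hi' : i ∈ Finset.univ \ (u.support ∪ v.support) := hi
    simp only [Finset.mem_sdiff, Finset.mem_univ, true_and, Finset.mem_union, not_or,
      Finsupp.notMem_support_iff] at hi'
    simp [hi'.1, hi'.2]

/-- Pairs of disjoint monomials of the same types lie in the same orbit. -/
theorem exists_perm_mapDomain (u v u' v' : Fin n →₀ ℕ) (hd : Disjoint u.support v.support)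
    (hd' : Disjoint u'.support v'.support) (hu : typeOf n u = typeOf n u')
    (hv : typeOf n v = typeOf n v') :
    ∃ σ : Equiv.Perm (Fin n), u.mapDomain σ = u' ∧ v.mapDomain σ = v' := by
  have h1 := map_univ_triple n u v hd (fun _ => ()) () (fun _ _ => rfl)
  have h2 := map_univ_triple n u' v' hd' (fun _ => ()) () (fun _ _ => rfl)
  have hc : (Finset.univ \ (u.support ∪ v.support)).card =
      (Finset.univ \ (u'.support ∪ v'.support)).card := by
    rw [Finset.card_sdiff_of_subset (Finset.subset_univ _),
      Finset.card_sdiff_of_subset (Finset.subset_univ _),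
      Finset.card_union_of_disjoint hd, Finset.card_union_of_disjoint hd',
      ← typeOf_card, ← typeOf_card, ← typeOf_card, ← typeOf_card, hu, hv]
  rw [hu, hv, Multiset.map_const', Finset.card_val, hc] at h1
  rw [Multiset.map_const', Finset.card_val] at h2
  obtain ⟨σ, hσ⟩ := exists_perm_of_map_univ_eq _ _ (h1.trans h2.symm)
  refine ⟨σ, Finsupp.ext fun i => ?_, Finsupp.ext fun i => ?_⟩
  · have := congrArg Prod.fst (hσ (σ.symm i))
    simpa [Finsupp.mapDomain_equiv_apply] using this.symm
  · have := congrArg (fun p => p.2.1) (hσ (σ.symm i))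
    simpa [Finsupp.mapDomain_equiv_apply] using this.symm

/-- Two disjoint monomials of the same type are swapped by a permutation fixing all variables
outside their supports. -/
theorem exists_perm_swap (u v : Fin n →₀ ℕ) (hd : Disjoint u.support v.support)
    (huv : typeOf n u = typeOf n v) :
    ∃ σ : Equiv.Perm (Fin n), u.mapDomain σ = v ∧ v.mapDomain σ = u ∧
      ∀ i ∉ u.support ∪ v.support, σ i = i := by
  let w : Fin n → Option (Fin n) := fun i => if i ∈ u.support ∪ v.support then none else some i
  have hw : ∀ i ∈ u.support ∪ v.support, w i = none := fun i hi => if_pos hi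
  have hw' : ∀ i ∈ v.support ∪ u.support, w i = none := fun i hi =>
    hw i (by rwa [Finset.union_comm])
  have h1 := map_univ_triple n u v hd w none hw
  have h2 := map_univ_triple n v u hd.symm w none hw'
  rw [huv] at h1
  rw [huv, Finset.union_comm] at h2
  obtain ⟨σ, hσ⟩ := exists_perm_of_map_univ_eq _ _ (h1.trans h2.symm)
  refine ⟨σ, Finsupp.ext fun i => ?_, Finsupp.ext fun i => ?_, fun i hi => ?_⟩
  · have := congrArg Prod.fst (hσ (σ.symm i))
    simpa [Finsupp.mapDomain_equiv_apply] using this.symm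
  · have := congrArg (fun p => p.2.1) (hσ (σ.symm i))
    simpa [Finsupp.mapDomain_equiv_apply] using this.symm
  · have := congrArg (fun p => p.2.2) (hσ i)
    simp only [w, if_neg hi] at this
    split_ifs at this
    exact Option.some_injective _ this

theorem mapDomain_eq_self (m : Fin n →₀ ℕ) (σ : Equiv.Perm (Fin n))
    (h : ∀ i ∈ m.support, σ i = i) : m.mapDomain σ = m := by
  conv_rhs => rw [← Finsupp.mapDomain_id (v := m)]
  exact Finsupp.mapDomain_congr h

/-- Every multiset of positive integers is the type of a monomial supported in a prescribed set
of sufficiently many variables. -/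
theorem exists_typeOf_eq (s : Multiset ℕ) : ∀ A : Finset (Fin n), (∀ x ∈ s, 0 < x) →
    s.card ≤ A.card → ∃ e : Fin n →₀ ℕ, typeOf n e = s ∧ e.support ⊆ A := by
  induction s using Multiset.induction_on with
  | empty => exact fun A _ _ => ⟨0, by simp [typeOf], by simp⟩
  | cons a s ih =>
    intro A hpos hcard
    rw [Multiset.card_cons] at hcard
    obtain ⟨x, hx⟩ := Finset.card_pos.mp (by omega : 0 < A.card)
    obtain ⟨e, he, hsub⟩ := ih (A.erase x) (fun y hy => hpos y (Multiset.mem_cons_of_mem hy))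
      (by rw [Finset.card_erase_of_mem hx]; omega)
    have hxe : x ∉ e.support := fun h => by simpa using hsub h
    have ha : a ≠ 0 := (hpos a (Multiset.mem_cons_self a s)).ne'
    have hsupp := Finsupp.support_single_add hxe ha
    refine ⟨Finsupp.single x a + e, ?_, ?_⟩
    · rw [typeOf, hsupp, Finset.cons_val, Multiset.map_cons, ← he, typeOf]
      congr 1
      · simp [Finsupp.notMem_support_iff.mp hxe]
      · refine Multiset.map_congr rfl fun i hi => ?_
        have : x ≠ i := by rintro rfl; exact hxe hi
        simp [this]
    · rw [hsupp]
      intro i hi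
      rcases Finset.mem_cons.mp hi with rfl | hi
      · exact hx
      · exact Finset.mem_of_mem_erase (hsub hi)

theorem card_le_sum_of_pos (s : Multiset ℕ) (h : ∀ x ∈ s, 0 < x) : s.card ≤ s.sum := by
  have := Multiset.card_nsmul_le_sum (s := s) (a := 1) h
  simpa using this

theorem rename_mem_psi (f g : MvPolynomial (Fin n) k) (hg : g ∈ psi k n f)
    (σ : Equiv.Perm (Fin n)) : rename σ g ∈ psi k n f := by
  have : psi k n f ≤ (psi k n f).comap (rename (R := k) σ) := by
    rw [psi, Ideal.span_le]
    rintro _ ⟨τ, rfl⟩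
    refine Ideal.subset_span ⟨τ.trans σ, ?_⟩
    rw [rename_rename]
    rfl
  exact this hg

/-- The sum of the coefficients of the monomials of type `lam`. -/
def coeffSum (lam : Multiset ℕ) : MvPolynomial (Fin n) k →ₗ[k] k :=
  (basisMonomials (Fin n) k).constr k fun e => if typeOf n e = lam then 1 else 0

theorem coeffSum_monomial (lam : Multiset ℕ) (e : Fin n →₀ ℕ) (c : k) :
    coeffSum k n lam (monomial e c) = if typeOf n e = lam then c else 0 := by
  have h : (monomial e c : MvPolynomial (Fin n) k) = c • basisMonomials (Fin n) k e := by
    simp [smul_monomial]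
  rw [h, map_smul, coeffSum, Module.Basis.constr_basis]
  simp

theorem coeffSum_mul_monomial (lam : Multiset ℕ) (e : Fin n →₀ ℕ) (he : wt n e = lam.sum)
    (a : MvPolynomial (Fin n) k) :
    coeffSum k n lam (a * monomial e 1) =
      constantCoeff a * if typeOf n e = lam then 1 else 0 := by
  induction a using MvPolynomial.induction_on' with
  | monomial m c =>
    rw [monomial_mul, coeffSum_monomial, constantCoeff_monomial]
    by_cases hm : m = 0
    · simp [hm]
    · have : typeOf n (m + e) ≠ lam := by
        intro h
        have h' := congrArg Multiset.sum h
        rw [typeOf_sum, ← he, wt_eq_degree, wt_eq_degree, map_add] at h'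
        exact hm ((Finsupp.degree_eq_zero_iff m).mp (by omega))
      simp [hm, this]
  | add p q hp hq => rw [add_mul, map_add, hp, hq, map_add, add_mul]

theorem coeffSum_eq_sum (lam : Multiset ℕ) (g : MvPolynomial (Fin n) k) :
    coeffSum k n lam g = ∑ e ∈ g.support, if typeOf n e = lam then coeff e g else 0 := by
  conv_lhs => rw [g.as_sum]
  rw [map_sum]
  exact Finset.sum_congr rfl fun e _ => coeffSum_monomial k n lam e _

theorem typeOf_mapDomain (m : Fin n →₀ ℕ) (σ : Equiv.Perm (Fin n)) :
    typeOf n (m.mapDomain σ) = typeOf n m := by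
  have hs : (m.mapDomain σ).support = m.support.map σ.toEmbedding := by
    rw [Finset.map_eq_image]
    exact Finsupp.mapDomain_support_of_injective σ.injective m
  rw [typeOf, hs, Finset.map_val, Multiset.map_map, typeOf]
  refine Multiset.map_congr rfl fun i _ => ?_
  simp [Finsupp.mapDomain_equiv_apply]

theorem typeOf_single (i : Fin n) (d : ℕ) (hd : d ≠ 0) :
    typeOf n (Finsupp.single i d) = {d} := by
  simp [typeOf, Finsupp.support_single i hd]

theorem monomial_sub_monomial_mem_psi_of_disjoint (f : MvPolynomial (Fin n) k)
    (u v u' v' : Fin n →₀ ℕ) (hd : Disjoint u.support v.support)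
    (hd' : Disjoint u'.support v'.support) (hu : typeOf n u = typeOf n u')
    (hv : typeOf n v = typeOf n v')
    (h : (monomial u 1 - monomial v 1 : MvPolynomial (Fin n) k) ∈ psi k n f) :
    (monomial u' 1 - monomial v' 1 : MvPolynomial (Fin n) k) ∈ psi k n f := by
  obtain ⟨σ, h1, h2⟩ := exists_perm_mapDomain n u v u' v' hd hd' hu hv
  have := rename_mem_psi k n f _ h σ
  rwa [map_sub, rename_monomial, rename_monomial, h1, h2] at this

/-- If the ideal contains one binomial in disjoint monomials of type `lam`, it contains all
binomials of this type. -/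
theorem monomial_sub_monomial_mem_psi (f : MvPolynomial (Fin n) k) (u v : Fin n →₀ ℕ)
    (hd : Disjoint u.support v.support) (huv : typeOf n u = typeOf n v)
    (hn : 3 * wt n u ≤ n)
    (h : (monomial u 1 - monomial v 1 : MvPolynomial (Fin n) k) ∈ psi k n f)
    (m m' : Fin n →₀ ℕ) (hm : typeOf n m = typeOf n u) (hm' : typeOf n m' = typeOf n u) :
    (monomial m 1 - monomial m' 1 : MvPolynomial (Fin n) k) ∈ psi k n f := by
  have hc := card_le_sum_of_pos _ (typeOf_pos n u)
  rw [typeOf_sum] at hc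
  obtain ⟨e, he, hsub⟩ := exists_typeOf_eq n (typeOf n u)
    (Finset.univ \ (m.support ∪ m'.support)) (typeOf_pos n u) (by
      have h1 := Finset.card_union_le m.support m'.support
      rw [← typeOf_card, ← typeOf_card, hm, hm'] at h1
      rw [Finset.card_sdiff_of_subset (Finset.subset_univ _), Finset.card_univ, Fintype.card_fin]
      omega)
  have hdis : ∀ a : Fin n →₀ ℕ, a.support ⊆ m.support ∪ m'.support →
      Disjoint a.support e.support := fun a ha =>
    Finset.disjoint_of_subset_left ha
      (Finset.disjoint_of_subset_right hsub Finset.disjoint_sdiff)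
  have h1 := monomial_sub_monomial_mem_psi_of_disjoint k n f u v m e hd
    (hdis m Finset.subset_union_left) hm.symm (huv.symm.trans he.symm) h
  have h2 := monomial_sub_monomial_mem_psi_of_disjoint k n f u v m' e hd
    (hdis m' Finset.subset_union_right) hm'.symm (huv.symm.trans he.symm) h
  simpa using (psi k n f).sub_mem h1 h2

/-- A form of degree `d` lies in an ideal as soon as its coefficient sums over all types other than
`(d)` vanish, provided the ideal contains the pure powers and identifies monomials of equal
type. -/
theorem mem_of_coeffSum_eq_zero (d : ℕ) (I : Ideal (MvPolynomial (Fin n) k))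
    (hbin : ∀ m m' : Fin n →₀ ℕ, wt n m = d → typeOf n m = typeOf n m' →
      (monomial m 1 - monomial m' 1 : MvPolynomial (Fin n) k) ∈ I)
    (hpow : ∀ m : Fin n →₀ ℕ, typeOf n m = {d} → (monomial m 1 : MvPolynomial (Fin n) k) ∈ I)
    (g : MvPolynomial (Fin n) k) (hg : g ∈ homogeneousSubmodule (Fin n) k d)
    (hL : ∀ lam : Multiset ℕ, lam.sum = d → (∀ x ∈ lam, 0 < x) → lam ≠ {d} →
      coeffSum k n lam g = 0) : g ∈ I := by
  let T : Multiset ℕ → MvPolynomial (Fin n) k := fun lam =>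
    if h : ∃ e : Fin n →₀ ℕ, typeOf n e = lam then monomial h.choose 1 else 0
  have hT : ∀ m : Fin n →₀ ℕ, wt n m = d →
      (monomial m 1 : MvPolynomial (Fin n) k) - T (typeOf n m) ∈ I := by
    intro m hm
    have h : ∃ e : Fin n →₀ ℕ, typeOf n e = typeOf n m := ⟨m, rfl⟩
    simp only [T, dif_pos h]
    exact hbin m _ hm h.choose_spec.symm
  have hwt : ∀ e ∈ g.support, wt n e = d := by
    intro e he
    by_contra hne
    exact (mem_support_iff.mp he)
      (((mem_homogeneousSubmodule d g).mp hg).coeff_eq_zero (by rwa [← wt_eq_degree]))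
  have h1 : g - ∑ e ∈ g.support, C (coeff e g) * T (typeOf n e) ∈ I := by
    nth_rewrite 1 [g.as_sum]
    rw [← Finset.sum_sub_distrib]
    refine I.sum_mem fun e he => ?_
    have : (monomial e (coeff e g) : MvPolynomial (Fin n) k) =
        C (coeff e g) * monomial e 1 := by rw [C_mul_monomial, mul_one]
    rw [this, ← mul_sub]
    exact I.mul_mem_left _ (hT e (hwt e he))
  have h2 : ∑ e ∈ g.support, C (coeff e g) * T (typeOf n e) =
      ∑ lam ∈ g.support.image (typeOf n), C (coeffSum k n lam g) * T lam := by
    simp_rw [coeffSum_eq_sum, map_sum, Finset.sum_mul]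
    rw [Finset.sum_comm]
    refine Finset.sum_congr rfl fun e he => ?_
    rw [Finset.sum_eq_single (typeOf n e)]
    · simp
    · intro lam _ hne
      simp [hne.symm]
    · intro h
      exact absurd (Finset.mem_image_of_mem _ he) h
  have h3 : ∑ lam ∈ g.support.image (typeOf n), C (coeffSum k n lam g) * T lam ∈ I := by
    refine I.sum_mem fun lam hlam => ?_
    obtain ⟨e, he, rfl⟩ := Finset.mem_image.mp hlam
    by_cases hd : typeOf n e = {d}
    · refine I.mul_mem_left _ ?_
      simpa using I.sub_mem (hpow e hd) (hT e (hwt e he))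
    · rw [hL _ (by rw [typeOf_sum, hwt e he]) (typeOf_pos n e) hd]
      simp
  have := I.add_mem h1 h3
  rwa [h2, sub_add_cancel] at this

/-- The coefficient sums over all types other than `(d)`, on forms of degree `d`. -/
def coeffSums (d : ℕ) : homogeneousSubmodule (Fin n) k d →ₗ[k]
    ({q : Nat.Partition d | q ≠ Nat.Partition.indiscrete d} → k) :=
  LinearMap.pi fun q => (coeffSum k n q.1.parts).domRestrict _

theorem coeffSums_surjective (d : ℕ) (hn : d ≤ n) : Function.Surjective (coeffSums k n d) := by
  intro y
  have hex : ∀ q : Nat.Partition d, ∃ e : Fin n →₀ ℕ, typeOf n e = q.parts := fun q => by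
    obtain ⟨e, he, -⟩ := exists_typeOf_eq n q.parts Finset.univ (fun x hx => q.parts_pos hx) (by
      have := card_le_sum_of_pos q.parts (fun x hx => q.parts_pos hx)
      rw [q.parts_sum] at this
      simpa using this.trans hn)
    exact ⟨e, he⟩
  choose e he using hex
  refine ⟨⟨∑ q, monomial (e q.1) (y q), Submodule.sum_mem _ fun q _ => ?_⟩, ?_⟩
  · refine (mem_homogeneousSubmodule d _).mpr (isHomogeneous_monomial _ ?_)
    rw [← wt_eq_degree, ← typeOf_sum, he, q.1.parts_sum]
  · funext q
    simp only [coeffSums, LinearMap.pi_apply, LinearMap.domRestrict_apply, map_sum,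
      coeffSum_monomial, he]
    rw [Finset.sum_eq_single q]
    · simp
    · intro b _ hb
      rw [if_neg]
      intro h
      exact hb (Subtype.ext (Nat.Partition.ext h))
    · simp

theorem finrank_ker_coeffSums (d : ℕ) (hn : d ≤ n) :
    Module.finrank k (LinearMap.ker (coeffSums k n d)) + (Pnum d - 1) = rdim k n d := by
  have : Module.Finite k (homogeneousSubmodule (Fin n) k d) :=
    Module.Finite.iff_fg.mpr (homogeneousSubmodule_fg (Fin n) k d)
  have h := LinearMap.finrank_range_add_finrank_ker (coeffSums k n d)
  rw [LinearMap.range_eq_top.mpr (coeffSums_surjective k n d hn), finrank_top,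
    Module.finrank_fintype_fun_eq_card, Set.card_ne_eq] at h
  rw [rdim, ← h, add_comm, Pnum]

/-- Proposition `lem:generalexample`(2): for the polynomial
`f = x_1^d + Σ_{λ⊢d, λ≠(d)} Σ_{γ⊊λ} b(λ,γ)` built from admissible binomials with pairwise
disjoint variable supports (`char k ≠ 2`, `n > 3d`), the principal symmetric ideal
`I = (f)_{S_n}` satisfies `dim_k I_d = dim_k R_d − (P(d) − 1)`. -/
theorem stmt11 (d : ℕ) (hd : 2 ≤ d) (hn : 3 * d < n) (hchar : ringChar k ≠ 2)
    (u v : Multiset ℕ × Multiset ℕ → (Fin n →₀ ℕ))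
    (hfin : (PairSet d).Finite)
    (htype : ∀ p ∈ PairSet d, typeOf n (u p) = p.1 ∧ typeOf n (v p) = p.1)
    (hne : ∀ p ∈ PairSet d, u p ≠ v p)
    (hadm : ∀ p ∈ PairSet d, ∀ i : Fin n, (u p) i = (v p) i ∨ min ((u p) i) ((v p) i) = 0)
    (hgcd : ∀ p ∈ PairSet d,
      typeOf n (Finsupp.zipWith min (by simp) (u p) (v p)) = p.2)
    (hdisj : ∀ p ∈ PairSet d, ∀ q ∈ PairSet d, p ≠ q →
      Disjoint ((u p).support ∪ (v p).support) ((u q).support ∪ (v q).support))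
    (h0 : ∀ p ∈ PairSet d, (⟨0, by omega⟩ : Fin n) ∉ (u p).support ∪ (v p).support)
    (f : MvPolynomial (Fin n) k)
    (hf : f = monomial (Finsupp.single (⟨0, by omega⟩ : Fin n) d) 1 +
      ∑ p ∈ hfin.toFinset, (monomial (u p) 1 - monomial (v p) 1)) :
    Module.finrank k ↥(Igrade k n (psi k n f) d) + (Pnum d - 1) = rdim k n d := by
  have hmem0 : ∀ lam : Multiset ℕ, lam.sum = d → (∀ x ∈ lam, 0 < x) → lam ≠ {d} →
      (lam, 0) ∈ PairSet d := by
    intro lam hs hp hl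
    refine ⟨hs, hp, hl, ?_⟩
    refine lt_of_le_of_ne (Multiset.zero_le _) ?_
    rintro h
    have h' : lam = 0 := h.symm
    rw [h', Multiset.sum_zero] at hs
    omega
  have hdis0 : ∀ lam : Multiset ℕ, (lam, 0) ∈ PairSet d →
      Disjoint (u (lam, 0)).support (v (lam, 0)).support := by
    intro lam hp
    have hg := hgcd _ hp
    rw [typeOf, Multiset.map_eq_zero, Finset.val_eq_zero, Finsupp.support_eq_empty] at hg
    rw [Finset.disjoint_left]
    intro i hi hj
    have := DFunLike.congr_fun hg i
    rw [Finsupp.zipWith_apply, Finsupp.zero_apply] at this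
    rw [Finsupp.mem_support_iff] at hi hj
    omega
  have hfI : f ∈ psi k n f := Ideal.subset_span ⟨1, by simp⟩
  have h2 : (2 : k) ≠ 0 := Ring.two_ne_zero hchar
  have hb : ∀ lam : Multiset ℕ, (lam, 0) ∈ PairSet d →
      (monomial (u (lam, 0)) 1 - monomial (v (lam, 0)) 1 : MvPolynomial (Fin n) k)
        ∈ psi k n f := by
    intro lam hp
    obtain ⟨σ, h1, h1', hfix⟩ := exists_perm_swap n _ _ (hdis0 lam hp)
      ((htype _ hp).1.trans (htype _ hp).2.symm)
    have hself : ∀ m : Fin n →₀ ℕ,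
        Disjoint m.support ((u (lam, 0)).support ∪ (v (lam, 0)).support) →
        m.mapDomain σ = m := fun m hm =>
      mapDomain_eq_self n m σ fun i hi => hfix i (Finset.disjoint_left.mp hm hi)
    have hq : ∀ q ∈ hfin.toFinset.erase (lam, 0),
        rename σ (monomial (u q) 1 - monomial (v q) 1 : MvPolynomial (Fin n) k) =
          monomial (u q) 1 - monomial (v q) 1 := by
      intro q hq
      rw [Finset.mem_erase, Set.Finite.mem_toFinset] at hq
      have hdq := hdisj q hq.2 _ hp hq.1
      rw [map_sub, rename_monomial, rename_monomial,
        hself _ (Finset.disjoint_of_subset_left Finset.subset_union_left hdq),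
        hself _ (Finset.disjoint_of_subset_left Finset.subset_union_right hdq)]
    have h00 : rename σ (monomial (Finsupp.single (⟨0, by omega⟩ : Fin n) d) 1 :
        MvPolynomial (Fin n) k) = monomial (Finsupp.single (⟨0, by omega⟩ : Fin n) d) 1 := by
      rw [rename_monomial, Finsupp.mapDomain_single, hfix _ (h0 _ hp)]
    have hf' := hf
    rw [← Finset.add_sum_erase _ _ (hfin.mem_toFinset.mpr hp)] at hf'
    have hσ := congrArg (rename σ) hf'
    rw [map_add, map_add, map_sum, Finset.sum_congr rfl hq, h00, map_sub, rename_monomial,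
      rename_monomial, h1, h1'] at hσ
    have hsub := (psi k n f).sub_mem hfI (rename_mem_psi k n f f hfI σ)
    have heq : f - rename σ f =
        C 2 * (monomial (u (lam, 0)) 1 - monomial (v (lam, 0)) 1) := by
      rw [hσ]
      nth_rewrite 1 [hf']
      rw [map_ofNat]
      ring
    rw [heq] at hsub
    have := (psi k n f).mul_mem_left (C (2⁻¹ : k)) hsub
    rwa [← mul_assoc, ← C_mul, inv_mul_cancel₀ h2, C_1, one_mul] at this
  have hbin' : ∀ m m' : Fin n →₀ ℕ, wt n m = d → typeOf n m = typeOf n m' →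
      typeOf n m ≠ {d} →
      (monomial m 1 - monomial m' 1 : MvPolynomial (Fin n) k) ∈ psi k n f := by
    intro m m' hm ht hl
    have hp := hmem0 (typeOf n m) (by rw [typeOf_sum, hm]) (typeOf_pos n m) hl
    have hty := htype _ hp
    refine monomial_sub_monomial_mem_psi k n f _ _ (hdis0 _ hp) (hty.1.trans hty.2.symm) ?_
      (hb _ hp) m m' hty.1.symm (ht.symm.trans hty.1.symm)
    rw [← typeOf_sum, hty.1, typeOf_sum, hm]
    omega
  have hx : (monomial (Finsupp.single (⟨0, by omega⟩ : Fin n) d) 1 : MvPolynomial (Fin n) k)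
      ∈ psi k n f := by
    have hsum : ∑ p ∈ hfin.toFinset,
        (monomial (u p) 1 - monomial (v p) 1 : MvPolynomial (Fin n) k) ∈ psi k n f := by
      refine (psi k n f).sum_mem fun p hp => ?_
      rw [Set.Finite.mem_toFinset] at hp
      have hty := htype p hp
      refine hbin' _ _ ?_ (hty.1.trans hty.2.symm) ?_
      · rw [← typeOf_sum, hty.1, hp.1]
      · rw [hty.1]
        exact hp.2.2.1
    have := (psi k n f).sub_mem hfI hsum
    rwa [← eq_sub_of_add_eq hf.symm] at this
  have hpow : ∀ m : Fin n →₀ ℕ, typeOf n m = {d} →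
      (monomial m 1 : MvPolynomial (Fin n) k) ∈ psi k n f := by
    intro m hm
    obtain ⟨σ, h1, -⟩ := exists_perm_mapDomain n (Finsupp.single (⟨0, by omega⟩ : Fin n) d) 0
      m 0 (by simp) (by simp) (by rw [typeOf_single n _ d (by omega), hm]) rfl
    have := rename_mem_psi k n f _ hx σ
    rwa [rename_monomial, h1] at this
  have hbin : ∀ m m' : Fin n →₀ ℕ, wt n m = d → typeOf n m = typeOf n m' →
      (monomial m 1 - monomial m' 1 : MvPolynomial (Fin n) k) ∈ psi k n f := by
    intro m m' hm ht
    by_cases hl : typeOf n m = {d}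
    · exact (psi k n f).sub_mem (hpow m hl) (hpow m' (ht.symm.trans hl))
    · exact hbin' m m' hm ht hl
  have hvanish : ∀ lam : Multiset ℕ, lam.sum = d → lam ≠ {d} → ∀ g ∈ psi k n f,
      coeffSum k n lam g = 0 := by
    intro lam hs hl g hg
    suffices h : ∀ a, coeffSum k n lam (a * g) = 0 by simpa using h 1
    induction hg using Submodule.span_induction with
    | mem g hg =>
      obtain ⟨σ, rfl⟩ := hg
      intro a
      rw [hf, map_add, map_sum, mul_add, map_add, Finset.mul_sum, map_sum, rename_monomial,
        coeffSum_mul_monomial, if_neg, Finset.sum_eq_zero]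
      · simp
      · intro p hp
        rw [Set.Finite.mem_toFinset] at hp
        have hty := htype p hp
        rw [map_sub, mul_sub, map_sub, rename_monomial, rename_monomial, coeffSum_mul_monomial,
          coeffSum_mul_monomial, typeOf_mapDomain, typeOf_mapDomain, hty.1, hty.2, sub_self]
        · rw [← typeOf_sum, typeOf_mapDomain, hty.2, hp.1, hs]
        · rw [← typeOf_sum, typeOf_mapDomain, hty.1, hp.1, hs]
      · rw [typeOf_mapDomain, typeOf_single n _ d (by omega)]
        exact hl.symm
      · rw [← typeOf_sum, typeOf_mapDomain, typeOf_single n _ d (by omega), hs,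
          Multiset.sum_singleton]
    | zero => simp
    | add x y _ _ hx hy =>
      intro a
      rw [mul_add, map_add, hx, hy, add_zero]
    | smul b x _ hx =>
      intro a
      rw [smul_eq_mul, ← mul_assoc]
      exact hx _
  have hgrade : Igrade k n (psi k n f) d =
      (LinearMap.ker (coeffSums k n d)).map (homogeneousSubmodule (Fin n) k d).subtype := by
    have hind := Nat.Partition.indiscrete_parts (n := d) (by omega)
    ext g
    constructor
    · rintro ⟨hg, hgI⟩
      refine ⟨⟨g, hg⟩, LinearMap.mem_ker.mpr (funext fun q => ?_), rfl⟩
      exact hvanish q.1.parts q.1.parts_sum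
        (fun h => q.2 (Nat.Partition.ext (h.trans hind.symm))) g hgI
    · rintro ⟨g, hg, rfl⟩
      refine ⟨g.2, mem_of_coeffSum_eq_zero k n d _ hbin hpow g.1 g.2 fun lam hs hp hl => ?_⟩
      have hq : (⟨lam, fun {i} hi => hp i hi, hs⟩ : Nat.Partition d) ≠
          Nat.Partition.indiscrete d := fun h =>
        hl ((congrArg Nat.Partition.parts h).trans hind)
      exact congrFun (LinearMap.mem_ker.mp hg) ⟨_, hq⟩
  rw [hgrade, Submodule.finrank_map_subtype_eq]
  exact finrank_ker_coeffSums k n d (by omega)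

end PSI
end
end
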